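/- arXiv:0908.2717 — 2 statements merged into one kernel-verified Lean document; each statement's English description precedes it below -/
import Mathlib

section
/- Let ε > 0, γ > 0, N ∈ ℕ, and let ι : ℝ^{2N−1} → L²(ℝ) be the piecewise linear embedding sending (x_{−(N−1)}, …, x_{N−1}) to the continuous function that equals x_k at the node s_k^{N,ε} = k ε^{−γ}/N for k = −(N−1), …, N−1, equals ∓1 at s = ∓ε^{−γ}, is affine between consecutive nodes, and equals ∓1 outside [−ε^{−γ}, ε^{−γ}]. Let g : m + L²(ℝ) → ℝ be Fréchet differentiable with L²-gradient ∇g(x) ∈ L²(ℝ), and let g̃ : ℝ^{2N−1} → ℝ be the composition of ι (shifted into m + L²(ℝ)) with g, with Euclidean gradient ∇̃g̃. Then for every x ∈ ℝ^{2N−1}: ‖∇̃g̃(x)‖_{ℝ^{2N−1}} ≤ 2 √(ε^{−γ}/N) · ‖∇g(ι(x))‖_{L²(ℝ)}. -/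
open MeasureTheory Real Filter Topology

noncomputable section

open scoped RealInnerProductSpace

/-- The hat function centered at `c` with half-width `Δ`. -/
def hatFn (c Δ s : ℝ) : ℝ := max 0 (1 - |s - c| / Δ)

/-- The piecewise linear embedding `ι : ℝ^{2N−1} → {functions on ℝ}` sending
`x` to the continuous function equal to `x k` at the node
`s_k^{N,ε} = k ε^{−γ}/N` (`k = −(N−1), …, N−1`, here indexed by `Fin (2N−1)`),
equal to `∓1` at `∓ε^{−γ}`, affine between consecutive nodes, and constant
equal to `∓1` outside `[−ε^{−γ}, ε^{−γ}]`. -/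
def pwEmbed (ε γ : ℝ) (N : ℕ) (x : EuclideanSpace ℝ (Fin (2 * N - 1))) (s : ℝ) : ℝ :=
  (min 1 (max 0 ((s - (ε ^ (-γ) - ε ^ (-γ) / N)) / (ε ^ (-γ) / N))) -
      min 1 (max 0 ((-(ε ^ (-γ) - ε ^ (-γ) / N) - s) / (ε ^ (-γ) / N)))) +
    ∑ k : Fin (2 * N - 1),
      x k * hatFn (((k : ℝ) - ((N : ℝ) - 1)) * (ε ^ (-γ) / N)) (ε ^ (-γ) / N) s

lemma hatFn_nonneg' (c Δ s : ℝ) : 0 ≤ hatFn c Δ s := le_max_left _ _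

lemma hatFn_le_ind (c Δ s : ℝ) (hΔ : 0 < Δ) :
    hatFn c Δ s ≤ (Set.Icc (c - Δ) (c + Δ)).indicator (fun _ => (1 : ℝ)) s := by
  unfold hatFn
  by_cases h : s ∈ Set.Icc (c - Δ) (c + Δ)
  · rw [Set.indicator_of_mem h]
    have : 0 ≤ |s - c| / Δ := by positivity
    exact max_le (by norm_num) (by linarith)
  · rw [Set.indicator_of_notMem h]
    refine max_le le_rfl ?_
    by_contra hc
    push Not at hc
    apply h
    have h1 : |s - c| / Δ < 1 := by linarith
    rw [div_lt_one hΔ, abs_lt] at h1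
    constructor <;> linarith [h1.1, h1.2]

lemma hat_sum_le (n : ℕ) (a Δ s : ℝ) (hΔ : 0 < Δ) :
    ∑ k : Fin n, hatFn (((k : ℝ) - a) * Δ) Δ s ≤ 2 := by
  set j : ℤ := ⌊s / Δ + a⌋ with hj
  have key : ∀ k : Fin n, hatFn (((k : ℝ) - a) * Δ) Δ s ≤
      (if ((k : ℕ) : ℤ) = j then (1 : ℝ) else 0) + (if ((k : ℕ) : ℤ) = j + 1 then (1 : ℝ) else 0) := by
    intro k
    have hs : |s - ((k : ℝ) - a) * Δ| / Δ = |(s / Δ + a) - k| := by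
      rw [← abs_of_pos hΔ, ← abs_div, abs_of_pos hΔ]
      congr 1
      field_simp
      ring
    have hle1 : hatFn (((k : ℝ) - a) * Δ) Δ s ≤ 1 := by
      unfold hatFn
      have : 0 ≤ |s - ((k : ℝ) - a) * Δ| / Δ := by positivity
      exact max_le (by norm_num) (by linarith)
    by_cases h1 : ((k : ℕ) : ℤ) = j
    · rw [if_pos h1]
      split_ifs <;> linarith
    by_cases h2 : ((k : ℕ) : ℤ) = j + 1
    · rw [if_pos h2]
      split_ifs <;> linarith
    rw [if_neg h1, if_neg h2, add_zero]
    unfold hatFn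
    rw [hs]
    refine max_le le_rfl ?_
    have hf1 := Int.floor_le (s / Δ + a)
    have hf2 := Int.lt_floor_add_one (s / Δ + a)
    rw [← hj] at hf1 hf2
    have : ((k : ℕ) : ℤ) ≤ j - 1 ∨ j + 2 ≤ ((k : ℕ) : ℤ) := by omega
    rcases this with h | h
    · have h' : ((k : ℕ) : ℝ) ≤ (j : ℝ) - 1 := by exact_mod_cast h
      linarith [le_abs_self (s / Δ + a - k)]
    · have h' : (j : ℝ) + 2 ≤ ((k : ℕ) : ℝ) := by exact_mod_cast h
      linarith [neg_abs_le (s / Δ + a - k)]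
  have one : ∀ i : ℤ, ∑ k : Fin n, (if ((k : ℕ) : ℤ) = i then (1 : ℝ) else 0) ≤ 1 := by
    intro i
    rw [Finset.sum_boole]
    have : (Finset.univ.filter (fun k : Fin n => ((k : ℕ) : ℤ) = i)).card ≤ 1 := by
      rw [Finset.card_le_one]
      intro p hp q hq
      simp only [Finset.mem_filter, Finset.mem_univ, true_and] at hp hq
      ext
      omega
    exact_mod_cast this
  calc _ ≤ _ := Finset.sum_le_sum (fun k _ => key k)
    _ ≤ 2 := by
      rw [Finset.sum_add_distrib]
      linarith [one j, one (j + 1)]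

lemma hat_sq_le (n : ℕ) (a Δ s : ℝ) (hΔ : 0 < Δ) (v : Fin n → ℝ) :
    (∑ k : Fin n, v k * hatFn (((k : ℝ) - a) * Δ) Δ s) ^ 2 ≤
    2 * ∑ k : Fin n, v k ^ 2 *
      (Set.Icc (((k : ℝ) - a) * Δ - Δ) (((k : ℝ) - a) * Δ + Δ)).indicator (fun _ => (1 : ℝ)) s := by
  have cs := Finset.sum_sq_le_sum_mul_sum_of_sq_eq_mul Finset.univ
    (r := fun k : Fin n => v k * hatFn (((k : ℝ) - a) * Δ) Δ s)
    (f := fun k : Fin n => hatFn (((k : ℝ) - a) * Δ) Δ s)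
    (g := fun k : Fin n => v k ^ 2 * hatFn (((k : ℝ) - a) * Δ) Δ s)
    (fun k _ => hatFn_nonneg' _ _ _)
    (fun k _ => mul_nonneg (sq_nonneg _) (hatFn_nonneg' _ _ _))
    (fun k _ => by ring)
  refine cs.trans ?_
  refine mul_le_mul (hat_sum_le n a Δ s hΔ) ?_
    (Finset.sum_nonneg fun k _ => mul_nonneg (sq_nonneg _) (hatFn_nonneg' _ _ _)) (by norm_num)
  exact Finset.sum_le_sum fun k _ =>
    mul_le_mul_of_nonneg_left (hatFn_le_ind _ _ _ hΔ) (sq_nonneg _)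

lemma hat_norm_le (n : ℕ) (a Δ : ℝ) (hΔ : 0 < Δ) (v : EuclideanSpace ℝ (Fin n))
    (f : Lp ℝ 2 (volume : Measure ℝ))
    (hf : (f : ℝ → ℝ) =ᵐ[volume] fun s => ∑ k : Fin n, v k * hatFn (((k : ℝ) - a) * Δ) Δ s) :
    ‖f‖ ≤ 2 * Real.sqrt Δ * ‖v‖ := by
  have hint : ∀ k : Fin n, Integrable (fun s => v k ^ 2 *
      (Set.Icc (((k : ℝ) - a) * Δ - Δ) (((k : ℝ) - a) * Δ + Δ)).indicator
        (fun _ => (1 : ℝ)) s) volume := by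
    intro k
    refine Integrable.const_mul ?_ _
    rw [integrable_indicator_iff measurableSet_Icc]
    exact integrableOn_const (by simp)
  have hsq : ‖f‖ ^ 2 ≤ 4 * Δ * ‖v‖ ^ 2 := by
    rw [← real_inner_self_eq_norm_sq, L2.inner_def]
    calc ∫ s, ⟪f s, f s⟫ ≤ ∫ s, 2 * ∑ k : Fin n, v k ^ 2 *
          (Set.Icc (((k : ℝ) - a) * Δ - Δ) (((k : ℝ) - a) * Δ + Δ)).indicator
            (fun _ => (1 : ℝ)) s := by
          refine integral_mono_of_nonneg ?_ ?_ ?_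
          · exact Eventually.of_forall fun s => real_inner_self_nonneg
          · exact (integrable_finset_sum _ fun k _ => hint k).const_mul 2
          · filter_upwards [hf] with s hs
            rw [real_inner_self_eq_norm_sq, Real.norm_eq_abs, sq_abs, hs]
            exact hat_sq_le n a Δ s hΔ v
      _ = 4 * Δ * ‖v‖ ^ 2 := by
          rw [integral_const_mul, integral_finset_sum _ fun k _ => hint k,
            EuclideanSpace.norm_sq_eq, Finset.mul_sum, Finset.mul_sum]
          refine Finset.sum_congr rfl fun k _ => ?_
          rw [integral_const_mul, integral_indicator measurableSet_Icc]
          have : 0 ≤ Δ + Δ := by positivity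
          simp [this]
          ring
  refine abs_le_of_sq_le_sq' ?_ (by positivity) |>.2
  rw [mul_pow, mul_pow, Real.sq_sqrt hΔ.le]
  linarith

/-- the Euclidean gradient of the discretization `g̃ = g ∘ ι` of a
Fréchet differentiable function `g` on `m + L²(ℝ)` (represented on the Hilbert
space `L²(ℝ)` by subtracting the fixed profile `m`) is controlled by the
`L²`-gradient of `g`: `‖∇̃g̃(x)‖ ≤ 2 √(ε^{−γ}/N) ‖∇g(ι x)‖_{L²}`. -/
theorem discretized_gradient_bound
    (m : ℝ → ℝ) (hmcont : Continuous m) (hmbdd : ∃ Cb : ℝ, ∀ s : ℝ, |m s| ≤ Cb)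
    (hmtop : Tendsto m atTop (𝓝 1)) (hmbot : Tendsto m atBot (𝓝 (-1)))
    (ε γ : ℝ) (hε : 0 < ε) (hγ : 0 < γ) (N : ℕ) (hN : 0 < N)
    (g : Lp ℝ 2 (volume : Measure ℝ) → ℝ)
    (grad : Lp ℝ 2 (volume : Measure ℝ) → Lp ℝ 2 (volume : Measure ℝ))
    (hg : ∀ u : Lp ℝ 2 (volume : Measure ℝ),
      HasFDerivAt g (innerSL ℝ (grad u) : Lp ℝ 2 (volume : Measure ℝ) →L[ℝ] ℝ) u)
    (ι : EuclideanSpace ℝ (Fin (2 * N - 1)) → Lp ℝ 2 (volume : Measure ℝ))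
    (hι : ∀ x : EuclideanSpace ℝ (Fin (2 * N - 1)),
      (ι x : ℝ → ℝ) =ᵐ[(volume : Measure ℝ)] fun s => pwEmbed ε γ N x s - m s)
    (x gx : EuclideanSpace ℝ (Fin (2 * N - 1)))
    (hgx : HasFDerivAt (fun y => g (ι y))
      (innerSL ℝ gx : EuclideanSpace ℝ (Fin (2 * N - 1)) →L[ℝ] ℝ) x) :
    ‖gx‖ ≤ 2 * Real.sqrt (ε ^ (-γ) / N) * ‖grad (ι x)‖ := by
  have hΔ : 0 < ε ^ (-γ) / (N : ℝ) := by
    have := Real.rpow_pos_of_pos hε (-γ)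
    have : (0 : ℝ) < N := by exact_mod_cast hN
    positivity
  set L := ι (x + gx) - ι x with hL
  have hLae : (L : ℝ → ℝ) =ᵐ[volume] fun s => ∑ k : Fin (2 * N - 1),
      gx k * hatFn (((k : ℝ) - ((N : ℝ) - 1)) * (ε ^ (-γ) / N)) (ε ^ (-γ) / N) s := by
    filter_upwards [Lp.coeFn_sub (ι (x + gx)) (ι x), hι (x + gx), hι x] with s h1 h2 h3
    rw [hL, h1, Pi.sub_apply, h2, h3]
    simp only [pwEmbed, PiLp.add_apply, add_mul, Finset.sum_add_distrib]
    ring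
  have hline : ∀ t : ℝ, ι (x + t • gx) = ι x + t • L := by
    intro t
    apply Lp.ext
    filter_upwards [Lp.coeFn_add (ι x) (t • L), Lp.coeFn_smul t L, hLae,
      hι (x + t • gx), hι x] with s h1 h2 h3 h4 h5
    rw [h1, Pi.add_apply, h2, Pi.smul_apply, h3, h4, h5]
    simp only [pwEmbed, PiLp.add_apply, PiLp.smul_apply, smul_eq_mul, add_mul,
      Finset.sum_add_distrib, Finset.mul_sum, mul_assoc]
    ring
  have hnorm : ‖L‖ ≤ 2 * Real.sqrt (ε ^ (-γ) / N) * ‖gx‖ := hat_norm_le _ _ _ hΔ gx L hLae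
  have d1 : HasDerivAt (fun t : ℝ => g (ι (x + t • gx))) (⟪gx, gx⟫) 0 := by
    have := hgx.hasLineDerivAt gx
    simpa only [HasLineDerivAt, innerSL_apply_apply] using this
  have d2 : HasDerivAt (fun t : ℝ => g (ι (x + t • gx))) (⟪grad (ι x), L⟫) 0 := by
    have := (hg (ι x)).hasLineDerivAt L
    simp only [hline]
    simpa only [HasLineDerivAt, innerSL_apply_apply] using this
  have heq := d1.unique d2
  rw [real_inner_self_eq_norm_sq] at heq
  have hcs := real_inner_le_norm (grad (ι x)) L
  have h1 : ‖gx‖ ^ 2 ≤ ‖grad (ι x)‖ * (2 * Real.sqrt (ε ^ (-γ) / N) * ‖gx‖) := by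
    rw [heq]
    exact hcs.trans (mul_le_mul_of_nonneg_left hnorm (norm_nonneg _))
  rcases (norm_nonneg gx).eq_or_lt with h0 | h0
  · rw [← h0]
    positivity
  · refine le_of_mul_le_mul_right ?_ h0
    linarith
end
end

section
/- Let E be a separable Hilbert space and μ a centered Gaussian probability measure on E with covariance operator Σ (so Σ is a nonnegative self-adjoint trace-class operator with ∫ ⟨η₁, x⟩⟨η₂, x⟩ μ(dx) = ⟨η₁, Σ η₂⟩ for all η₁, η₂ ∈ E). Let σ² be the operator norm (spectral radius) of Σ. Then for every r ≥ 0: μ{x ∈ E : ‖x‖ ≥ (Tr Σ)^{1/2} + r} ≤ exp(−r²/(2σ²)). -/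
open MeasureTheory Real Filter Topology ProbabilityTheory

noncomputable section

open scoped RealInnerProductSpace ENNReal

lemma gch_one_dim (v : NNReal) (t L : ℝ) (ht : 0 ≤ t) (hvL : (v : ℝ) ≤ L) (htL : 2 * t * L < 1) :
    ∫⁻ y, ENNReal.ofReal (Real.exp (t * y ^ 2)) ∂(gaussianReal 0 v) ≤
      ENNReal.ofReal (Real.exp (t * v / (1 - 2 * t * L))) := by
  by_cases hv : v = 0
  · subst hv
    simp [gaussianReal_zero_var]
  have hvpos : 0 < (v : ℝ) := by positivity
  set u : ℝ := 1 - 2 * t * v with hu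
  have huL : 1 - 2 * t * L ≤ u := by rw [hu]; nlinarith
  have hupos : 0 < u := by linarith
  have hu1 : u ≤ 1 := by rw [hu]; nlinarith [mul_nonneg ht hvpos.le]
  let w : NNReal := ⟨v / u, by positivity⟩
  have hw : (w : ℝ) = v / u := rfl
  have hw0 : w ≠ 0 := by
    intro h
    have : (w : ℝ) = 0 := by simp [h]
    rw [hw] at this
    have : 0 < (v : ℝ) / u := by positivity
    linarith
  rw [gaussianReal_of_var_ne_zero _ hv,
    lintegral_withDensity_eq_lintegral_mul _ (measurable_gaussianPDF 0 v) (by fun_prop)]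
  have key : ∀ y : ℝ, (gaussianPDF 0 v * fun y => ENNReal.ofReal (Real.exp (t * y ^ 2))) y
      = ENNReal.ofReal ((√u)⁻¹) * gaussianPDF 0 w y := by
    intro y
    simp only [Pi.mul_apply, gaussianPDF]
    rw [← ENNReal.ofReal_mul (gaussianPDFReal_nonneg _ _ _), ← ENNReal.ofReal_mul (by positivity)]
    congr 1
    simp only [gaussianPDFReal, hw, sub_zero]
    rw [mul_assoc, ← Real.exp_add, ← mul_assoc]
    congr 1
    · rw [← mul_inv, ← Real.sqrt_mul hupos.le]
      congr 2
      field_simp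
    · congr 1
      field_simp
      rw [hu]; ring
  simp_rw [key]
  rw [lintegral_const_mul _ (measurable_gaussianPDF 0 w), lintegral_gaussianPDF_eq_one 0 hw0, mul_one]
  apply ENNReal.ofReal_le_ofReal
  have h1 : u⁻¹ ≤ Real.exp (u⁻¹ - 1) := by
    have := Real.add_one_le_exp (u⁻¹ - 1)
    linarith
  rw [← Real.sqrt_inv]
  calc √u⁻¹ ≤ √(Real.exp (u⁻¹ - 1)) := Real.sqrt_le_sqrt h1
    _ = Real.exp ((u⁻¹ - 1) / 2) := (Real.exp_half _).symm
    _ ≤ _ := by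
      apply Real.exp_le_exp.2
      have : (u⁻¹ - 1) / 2 = t * v / u := by
        field_simp
        rw [hu]; ring
      rw [this]
      apply div_le_div_of_nonneg_left (by positivity) (by linarith) huL

section
variable {E : Type*} [NormedAddCommGroup E] [InnerProductSpace ℝ E] [CompleteSpace E]
    [SecondCountableTopology E] [MeasurableSpace E] [BorelSpace E]

lemma gch_diag (μ : Measure E) [IsProbabilityMeasure μ]
    (hGauss : ∀ L : E →L[ℝ] ℝ, ∃ v : NNReal, Measure.map L μ = gaussianReal 0 v)
    (Cov : E →L[ℝ] E)
    (hCovIsCov : ∀ η₁ η₂ : E, (∫ x, ⟪η₁, x⟫ * ⟪η₂, x⟫ ∂μ) = ⟪η₁, Cov η₂⟫)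
    {n : ℕ} (e : Fin n → E) (he : ∀ i, ‖e i‖ = 1)
    (hd : ∀ i j, i ≠ j → ⟪e i, Cov (e j)⟫ = 0)
    (t : ℝ) (ht : 0 ≤ t) (htL : 2 * t * ‖Cov‖ < 1) :
    ∫⁻ x, ENNReal.ofReal (Real.exp (t * ∑ i, ⟪e i, x⟫ ^ 2)) ∂μ ≤
      ENNReal.ofReal (Real.exp (t * (∑ i, ⟪e i, Cov (e i)⟫) / (1 - 2 * t * ‖Cov‖))) := by
  have hmean : ∀ L : E →L[ℝ] ℝ, ∫ x, L x ∂μ = 0 := by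
    intro L
    obtain ⟨v, hv⟩ := hGauss L
    have : ∫ y, y ∂(Measure.map L μ) = ∫ x, L x ∂μ :=
      integral_map (by fun_prop) (by fun_prop)
    rw [← this, hv, integral_id_gaussianReal]
  have hvar : ∀ (L : E →L[ℝ] ℝ) (v : NNReal), Measure.map L μ = gaussianReal 0 v →
      Var[L; μ] = v := by
    intro L v hv
    have := variance_id_gaussianReal (μ := 0) (v := v)
    rw [← hv, variance_map (by fun_prop) (by fun_prop)] at this
    simpa using this
  have : IsGaussian μ := ⟨fun L => by
    obtain ⟨v, hv⟩ := hGauss L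
    rw [hmean L, hvar L v hv, hv]; simp⟩
  have hLp : ∀ i, MemLp (fun x => ⟪e i, x⟫) 2 μ := fun i =>
    (HasGaussianLaw.map (IsGaussian.hasGaussianLaw_id (μ := μ)) (innerSL ℝ (e i))).memLp
      (by simp)
  have hmean' : ∀ i, ∫ x, ⟪e i, x⟫ ∂μ = 0 := fun i => hmean (innerSL ℝ (e i))
  have hind : iIndepFun (fun (i : Fin n) (x : E) => ⟪e i, x⟫) μ := by
    apply HasGaussianLaw.iIndepFun_of_covariance_eq_zero
    · exact (IsGaussian.hasGaussianLaw_id (μ := μ)).map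
        (ContinuousLinearMap.pi (fun i => innerSL ℝ (e i)))
    · intro i j hij
      rw [covariance_eq_sub (hLp i) (hLp j), hmean' i]
      simp only [Pi.mul_apply, zero_mul, sub_zero]
      rw [hCovIsCov, hd i j hij]
  have hind2 := hind.comp (fun _ y => ENNReal.ofReal (Real.exp (t * y ^ 2)))
    (fun _ => by fun_prop)
  have hprod := lintegral_prod_eq_prod_lintegral_of_indepFun Finset.univ _ hind2
    (fun i => by fun_prop)
  have hlhs : ∀ x, ENNReal.ofReal (Real.exp (t * ∑ i, ⟪e i, x⟫ ^ 2)) =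
      ∏ i, ENNReal.ofReal (Real.exp (t * ⟪e i, x⟫ ^ 2)) := by
    intro x
    rw [Finset.mul_sum, Real.exp_sum, ENNReal.ofReal_prod_of_nonneg (fun _ _ => by positivity)]
  simp_rw [hlhs]
  simp only [Function.comp_def] at hprod
  rw [hprod, Finset.mul_sum, Finset.sum_div, Real.exp_sum,
    ENNReal.ofReal_prod_of_nonneg (fun _ _ => by positivity)]
  apply Finset.prod_le_prod' 
  intro i _
  obtain ⟨v, hv⟩ := hGauss (innerSL ℝ (e i))
  have hv2 : (v : ℝ) = ⟪e i, Cov (e i)⟫ := by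
    rw [← hCovIsCov, ← hvar _ v hv]
    change Var[fun x => ⟪e i, x⟫; μ] = _
    rw [variance_eq_sub (hLp i)]
    simp [hmean' i, pow_two]
  have hvL : (v : ℝ) ≤ ‖Cov‖ := by
    rw [hv2]
    calc _ ≤ ‖e i‖ * ‖Cov (e i)‖ := real_inner_le_norm _ _
      _ ≤ ‖e i‖ * (‖Cov‖ * ‖e i‖) := by gcongr; exact Cov.le_opNorm _
      _ = _ := by simp [he i]
  have := gch_one_dim v t ‖Cov‖ ht hvL htL
  rw [← hv, lintegral_map (by fun_prop) (by fun_prop)] at this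
  rw [← hv2]
  simpa using this

lemma gch_fin (μ : Measure E) [IsProbabilityMeasure μ]
    (hGauss : ∀ L : E →L[ℝ] ℝ, ∃ v : NNReal, Measure.map L μ = gaussianReal 0 v)
    (Cov : E →L[ℝ] E)
    (hCovSym : ∀ x y : E, ⟪Cov x, y⟫ = ⟪x, Cov y⟫)
    (hCovIsCov : ∀ η₁ η₂ : E, (∫ x, ⟪η₁, x⟫ * ⟪η₂, x⟫ ∂μ) = ⟪η₁, Cov η₂⟫)
    {ι : Type*} (b : ι → E) (hb : Orthonormal ℝ b) (s : Finset ι)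
    (t : ℝ) (ht : 0 ≤ t) (htL : 2 * t * ‖Cov‖ < 1) :
    ∫⁻ x, ENNReal.ofReal (Real.exp (t * ∑ i ∈ s, ⟪b i, x⟫ ^ 2)) ∂μ ≤
      ENNReal.ofReal (Real.exp (t * (∑ i ∈ s, ⟪b i, Cov (b i)⟫) / (1 - 2 * t * ‖Cov‖))) := by
  classical
  let V : Submodule ℝ E := Submodule.span ℝ (s.image b : Set E)
  let f : OrthonormalBasis s ℝ V := OrthonormalBasis.span hb s
  have hf : ∀ i, (f i : E) = b i := fun i => OrthonormalBasis.span_apply hb s i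
  have : FiniteDimensional ℝ V := f.toBasis.finiteDimensional_of_finite
  let T : V →ₗ[ℝ] V := (V.orthogonalProjectionOnto ∘L Cov ∘L V.subtypeL : V →L[ℝ] V)
  have hT : ∀ x y : V, ⟪x, T y⟫ = ⟪(x : E), Cov y⟫ := by
    intro x y
    simp [T]
  have hTs : T.IsSymmetric := by
    intro x y
    rw [hT, real_inner_comm, hT, ← hCovSym, real_inner_comm]
  let e := hTs.eigenvectorBasis rfl
  have h1 : ∀ x : E, ∑ i ∈ s, ⟪b i, x⟫ ^ 2 = ∑ i, ⟪(e i : E), x⟫ ^ 2 := by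
    intro x
    rw [← Finset.sum_coe_sort s]
    have a1 := e.sum_sq_inner_right (V.orthogonalProjectionOnto x)
    have a2 := f.sum_sq_inner_right (V.orthogonalProjectionOnto x)
    rw [← a1] at a2
    simpa [hf] using a2
  have h2 : ∑ i ∈ s, ⟪b i, Cov (b i)⟫ = ∑ i, ⟪(e i : E), Cov (e i)⟫ := by
    rw [← Finset.sum_coe_sort s]
    have a1 := T.trace_eq_sum_inner e
    have a2 := T.trace_eq_sum_inner f
    simp only [hT, hf] at a1 a2
    rw [← a1, ← a2]
  simp_rw [h1, h2]
  apply gch_diag μ hGauss Cov hCovIsCov (fun i => (e i : E)) _ _ t ht htL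
  · intro i
    exact e.orthonormal.1 i
  · intro i j hij
    rw [← hT, hTs.apply_eigenvectorBasis, inner_smul_right, e.orthonormal.2 hij, mul_zero]

lemma gch_exp (μ : Measure E) [IsProbabilityMeasure μ]
    (hGauss : ∀ L : E →L[ℝ] ℝ, ∃ v : NNReal, Measure.map L μ = gaussianReal 0 v)
    (Cov : E →L[ℝ] E)
    (hCovSym : ∀ x y : E, ⟪Cov x, y⟫ = ⟪x, Cov y⟫)
    (hCovNonneg : ∀ x : E, 0 ≤ ⟪x, Cov x⟫)
    (hCovIsCov : ∀ η₁ η₂ : E, (∫ x, ⟪η₁, x⟫ * ⟪η₂, x⟫ ∂μ) = ⟪η₁, Cov η₂⟫)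
    {ι : Type*} (b : HilbertBasis ι ℝ E) (trCov : ℝ)
    (htr : HasSum (fun i => ⟪b i, Cov (b i)⟫) trCov)
    (t : ℝ) (ht : 0 ≤ t) (htL : 2 * t * ‖Cov‖ < 1) :
    ∫⁻ x, ENNReal.ofReal (Real.exp (t * ‖x‖ ^ 2)) ∂μ ≤
      ENNReal.ofReal (Real.exp (t * trCov / (1 - 2 * t * ‖Cov‖))) := by
  have hcount : Countable ι := by
    apply Pairwise.countable_of_isOpen_disjoint (s := fun i => Metric.ball (b i) (1 / 2))
    · intro i j hij
      apply Metric.ball_disjoint_ball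
      rw [dist_eq_norm]
      have h := norm_sub_sq_real (b i) (b j)
      rw [b.orthonormal.2 hij, b.orthonormal.1 i, b.orthonormal.1 j] at h
      nlinarith [norm_nonneg (b i - b j)]
    · intro i; exact Metric.isOpen_ball
    · intro i; exact ⟨b i, by simp⟩
  have hlim : ∀ x : E, Tendsto (fun s : Finset ι =>
      ENNReal.ofReal (Real.exp (t * ∑ i ∈ s, ⟪b i, x⟫ ^ 2))) atTop
      (𝓝 (ENNReal.ofReal (Real.exp (t * ‖x‖ ^ 2)))) := by
    intro x
    have h := b.hasSum_inner_mul_inner x x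
    rw [real_inner_self_eq_norm_sq] at h
    have h' : HasSum (fun i => ⟪b i, x⟫ ^ 2) (‖x‖ ^ 2) := by
      have h2 : (fun i => ⟪b i, x⟫ ^ 2) = fun i => ⟪x, b i⟫ * ⟪b i, x⟫ := by
        funext i
        rw [real_inner_comm (b i) x, pow_two]
      rw [h2]
      exact h
    exact ENNReal.tendsto_ofReal ((Real.continuous_exp.tendsto _).comp (Tendsto.const_mul t h'))
  calc ∫⁻ x, ENNReal.ofReal (Real.exp (t * ‖x‖ ^ 2)) ∂μ
      = ∫⁻ x, liminf (fun s : Finset ι =>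
          ENNReal.ofReal (Real.exp (t * ∑ i ∈ s, ⟪b i, x⟫ ^ 2))) atTop ∂μ := by
        congr 1; ext x; exact (hlim x).liminf_eq.symm
    _ ≤ liminf (fun s : Finset ι => ∫⁻ x, 
          ENNReal.ofReal (Real.exp (t * ∑ i ∈ s, ⟪b i, x⟫ ^ 2)) ∂μ) atTop :=
        lintegral_liminf_le (fun s => by fun_prop)
    _ ≤ _ := by
        apply liminf_le_of_frequently_le'
        apply Frequently.of_forall
        intro s
        refine (gch_fin μ hGauss Cov hCovSym hCovIsCov b b.orthonormal s t ht htL).trans ?_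
        apply ENNReal.ofReal_le_ofReal
        apply Real.exp_le_exp.2
        have : ∑ i ∈ s, ⟪b i, Cov (b i)⟫ ≤ trCov := sum_le_hasSum s (fun i _ => hCovNonneg _) htr
        have : 0 < 1 - 2 * t * ‖Cov‖ := by linarith
        gcongr

end

/-- Gaussian concentration inequality on a separable Hilbert space:
if `μ` is a centered Gaussian measure with covariance operator `Σ` (nonnegative,
self-adjoint, trace class, with trace `trCov`), and `σ² = ‖Σ‖` is its spectral
radius, then `μ{‖x‖ ≥ √(Tr Σ) + r} ≤ exp(−r²/(2σ²))`. -/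
theorem gaussian_concentration_hilbert
    {E : Type*} [NormedAddCommGroup E] [InnerProductSpace ℝ E] [CompleteSpace E]
    [SecondCountableTopology E] [MeasurableSpace E] [BorelSpace E]
    (μ : Measure E) [IsProbabilityMeasure μ]
    -- `μ` is a centered Gaussian measure:
    (hGauss : ∀ L : E →L[ℝ] ℝ, ∃ v : NNReal, Measure.map L μ = gaussianReal 0 v)
    (Cov : E →L[ℝ] E)
    (hCovSym : ∀ x y : E, ⟪Cov x, y⟫ = ⟪x, Cov y⟫)
    (hCovNonneg : ∀ x : E, 0 ≤ ⟪x, Cov x⟫)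
    -- `Cov` is the covariance operator of `μ`:
    (hCovIsCov : ∀ η₁ η₂ : E, (∫ x, ⟪η₁, x⟫ * ⟪η₂, x⟫ ∂μ) = ⟪η₁, Cov η₂⟫)
    -- `Cov` is trace class with trace `trCov`:
    {ι : Type*} (b : HilbertBasis ι ℝ E) (trCov : ℝ)
    (htr : HasSum (fun i => ⟪b i, Cov (b i)⟫) trCov)
    (r : ℝ) (hr : 0 ≤ r) :
    μ {x : E | Real.sqrt trCov + r ≤ ‖x‖} ≤
      ENNReal.ofReal (Real.exp (-(r ^ 2) / (2 * ‖Cov‖))) := by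
  have hT0 : 0 ≤ trCov := htr.nonneg (fun i => hCovNonneg _)
  rcases hr.eq_or_lt with rfl | hr
  · simpa using prob_le_one
  rcases (norm_nonneg Cov).eq_or_lt with hL | hL
  · rw [← hL]
    simpa using prob_le_one
  set L := ‖Cov‖ with hLdef
  set a := Real.sqrt trCov + r with ha
  have hs0 : 0 ≤ Real.sqrt trCov := Real.sqrt_nonneg _
  have hsq : Real.sqrt trCov ^ 2 = trCov := Real.sq_sqrt hT0
  have hapos : 0 < a := by linarith
  -- the Chernoff bound, parametrised by `θ = 1 - 2 t L`
  have key : ∀ θ : ℝ, 0 < θ → θ < 1 → μ {x : E | a ≤ ‖x‖} ≤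
      ENNReal.ofReal (Real.exp ((trCov / θ - trCov - a ^ 2 + θ * a ^ 2) / (2 * L))) := by
    intro θ h0 h1
    set t : ℝ := (1 - θ) / (2 * L) with htdef
    have ht : 0 < t := div_pos (by linarith) (by linarith)
    have htL : 1 - 2 * t * L = θ := by
      rw [htdef]; field_simp; ring
    have h := gch_exp μ hGauss Cov hCovSym hCovNonneg hCovIsCov b trCov htr t ht.le
      (by rw [← hLdef]; linarith)
    rw [← hLdef, htL] at h
    have hsub : {x : E | a ≤ ‖x‖} ⊆ {x : E | ENNReal.ofReal (Real.exp (t * a ^ 2)) ≤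
        ENNReal.ofReal (Real.exp (t * ‖x‖ ^ 2))} := by
      intro x hx
      have hx : a ≤ ‖x‖ := hx
      apply ENNReal.ofReal_le_ofReal
      apply Real.exp_le_exp.2
      gcongr
    refine (measure_mono hsub).trans ?_
    refine (meas_ge_le_lintegral_div (by fun_prop) (by simp [Real.exp_pos]) (by simp)).trans ?_
    refine (ENNReal.div_le_div_right h _).trans ?_
    rw [← ENNReal.ofReal_div_of_pos (Real.exp_pos _), ← Real.exp_sub]
    apply le_of_eq
    congr 2
    rw [htdef]
    field_simp
    ring
  rcases hs0.eq_or_lt with hz | hpos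
  · have hT : trCov = 0 := by rw [← hsq, ← hz]; simp
    have har : a = r := by rw [ha, ← hz, zero_add]
    have hlim : Tendsto (fun θ : ℝ =>
        ENNReal.ofReal (Real.exp ((trCov / θ - trCov - a ^ 2 + θ * a ^ 2) / (2 * L))))
        (𝓝[>] 0) (𝓝 (ENNReal.ofReal (Real.exp (-(r ^ 2) / (2 * L))))) := by
      have hc : Continuous (fun θ : ℝ =>
          ENNReal.ofReal (Real.exp ((trCov / θ - trCov - a ^ 2 + θ * a ^ 2) / (2 * L)))) := by
        simp only [hT, zero_div]
        exact ENNReal.continuous_ofReal.comp (by fun_prop)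
      have := hc.tendsto 0
      simp only [hT, har, zero_div, zero_mul, add_zero, sub_zero, zero_sub] at this ⊢
      exact this.mono_left nhdsWithin_le_nhds
    refine ge_of_tendsto hlim ?_
    filter_upwards [Ioo_mem_nhdsGT (zero_lt_one (α := ℝ))] with θ hθ
    exact key θ hθ.1 hθ.2
  · refine (key (Real.sqrt trCov / a) (by positivity) ?_).trans (le_of_eq ?_)
    · rw [div_lt_one hapos]; linarith
    · congr 3
      have : trCov / (Real.sqrt trCov / a) = Real.sqrt trCov * a := by
        nth_rw 1 [← hsq]
        field_simp
      rw [this]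
      have h2 : Real.sqrt trCov / a * a ^ 2 = Real.sqrt trCov * a := by field_simp
      rw [h2]
      have h3 : r = a - Real.sqrt trCov := by rw [ha]; ring
      rw [h3]
      nlinarith [hsq]
end
end
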